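/- Let ℓ ≥ 1 and r_1, …, r_ℓ ≥ 1 be integers with r = r_1 + … + r_ℓ, let μ_1, …, μ_ℓ be real numbers, and let t ∈ ℝ. Let s = (s_1, …, s_r) ∈ ℝ^r be the vector in which the value μ_i appears exactly r_i times, in order. Then ∫_{D} (1 − Σ_{i=2}^{ℓ} β_i)^{r_1 − 1} · Π_{i=2}^{ℓ} β_i^{r_i − 1} / ((r_1 − 1)! ⋯ (r_ℓ − 1)!) dβ = vol_{ℝ^{r-1}}( { (λ_2, …, λ_r) ∈ Δ_{r-1} : s_1(1 − Σ_{j=2}^{r} λ_j) + Σ_{j=2}^{r} s_j λ_j ≥ t } ), where D = { (β_2, …, β_ℓ) ∈ Δ_{ℓ-1} : μ_1(1 − Σ_{i=2}^{ℓ} β_i) + Σ_{i=2}^{ℓ} μ_i β_i ≥ t } and vol_{ℝ^{r-1}} denotes (r−1)-dimensional Lebesgue measure. -/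

import Mathlib

open MeasureTheory

/-- The density `y ^ n / n!` on the half line `y ≥ 0`, extended by zero. -/
noncomputable def sumDensity (n : ℕ) (y : ℝ) : ℝ :=
  (Set.Ici 0).indicator (fun y => y ^ n / (n.factorial : ℝ)) y

lemma sumDensity_nonneg (n : ℕ) (y : ℝ) : 0 ≤ sumDensity n y :=
  Set.indicator_nonneg (fun y (hy : 0 ≤ y) => by positivity) y

lemma measurable_sumDensity (n : ℕ) : Measurable (sumDensity n) :=
  Measurable.indicator (by fun_prop) measurableSet_Ici

/-- The measure on `ℝ` with density `sumDensity n`. -/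
noncomputable def sumMeasure (n : ℕ) : Measure ℝ :=
  volume.withDensity fun y => ENNReal.ofReal (sumDensity n y)

instance (n : ℕ) : SigmaFinite (sumMeasure n) :=
  SigmaFinite.withDensity_ofReal _

lemma lintegral_Iic_sumDensity (n : ℕ) (c : ℝ) :
    ∫⁻ y in Set.Iic c, ENNReal.ofReal (sumDensity n y) =
      ENNReal.ofReal (sumDensity (n + 1) c) := by
  have h : ∀ y, ENNReal.ofReal (sumDensity n y) =
      (Set.Ici 0).indicator (fun y => ENNReal.ofReal (y ^ n / (n.factorial : ℝ))) y := by
    intro y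
    by_cases hy : y ∈ Set.Ici (0 : ℝ) <;> simp [sumDensity, hy]
  simp_rw [h]
  rw [lintegral_indicator measurableSet_Ici, Measure.restrict_restrict measurableSet_Ici,
    Set.Ici_inter_Iic]
  rcases lt_or_ge c 0 with hc | hc
  · simp [sumDensity, hc]
  · rw [← ofReal_integral_eq_lintegral_ofReal]
    · rw [integral_Icc_eq_integral_Ioc, ← intervalIntegral.integral_of_le hc,
        intervalIntegral.integral_div, integral_pow]
      congr 1
      simp only [sumDensity, Set.mem_Ici, hc, Set.indicator_of_mem, Nat.factorial_succ]
      push_cast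
      have : (n.factorial : ℝ) ≠ 0 := by positivity
      field_simp
      simp
    · exact (Continuous.continuousOn (by fun_prop)).integrableOn_Icc
    · filter_upwards [ae_restrict_mem measurableSet_Icc] with y hy
      have := hy.1
      simp only [Pi.zero_apply]; positivity

lemma lintegral_Ici_sumDensity_sub (n : ℕ) (z : ℝ) :
    ∫⁻ a in Set.Ici 0, ENNReal.ofReal (sumDensity n (z - a)) =
      ENNReal.ofReal (sumDensity (n + 1) z) := by
  rw [← lintegral_Iic_sumDensity, ← lintegral_indicator measurableSet_Ici,
    ← lintegral_indicator measurableSet_Iic,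
    ← lintegral_sub_left_eq_self _ z]
  congr with a
  by_cases h : a ≤ z <;> simp [Set.indicator, h]

/-- The sum of `n + 1` nonnegative coordinates has density `y ^ n / n!`. -/
lemma map_sum_pi_restrict_Ici (n : ℕ) :
    (Measure.pi fun _ : Fin (n + 1) => (volume : Measure ℝ).restrict (Set.Ici 0)).map
      (fun x => ∑ i, x i) = sumMeasure n := by
  induction n with
  | zero =>
    have h : (fun x : Fin (0 + 1) → ℝ => ∑ i, x i) = MeasurableEquiv.funUnique (Fin 1) ℝ := by
      ext x
      simp [MeasurableEquiv.funUnique]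
    rw [h]
    refine (measurePreserving_funUnique _ (Fin 1)).map_eq.trans ?_
    rw [sumMeasure, ← withDensity_indicator_one measurableSet_Ici]
    congr with y
    by_cases hy : y ∈ Set.Ici (0 : ℝ) <;> simp [sumDensity, hy]
  | succ n ih =>
    refine Measure.ext_of_lintegral _ fun g hg => ?_
    rw [lintegral_map hg (by fun_prop),
      ← (measurePreserving_piFinSuccAbove
        (fun _ => (volume : Measure ℝ).restrict (Set.Ici 0)) 0).symm.lintegral_comp
        (by fun_prop), lintegral_prod _ (by fun_prop)]
    simp only [MeasurableEquiv.piFinSuccAbove_symm_apply, Fin.insertNthEquiv, Equiv.coe_fn_mk,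
      Fin.insertNth_zero', Fin.sum_univ_succ (n := n + 1), Fin.cons_zero, Fin.cons_succ]
    have h1 : ∀ a : ℝ, ∫⁻ x : Fin (n + 1) → ℝ, g (a + ∑ i, x i)
        ∂(Measure.pi fun _ => volume.restrict (Set.Ici 0)) =
        ∫⁻ z, ENNReal.ofReal (sumDensity n (z - a)) * g z := by
      intro a
      rw [← lintegral_map (f := fun y => g (a + y)) (by fun_prop) (by fun_prop), ih, sumMeasure,
        lintegral_withDensity_eq_lintegral_mul _ (measurable_sumDensity n).ennreal_ofReal
          (by fun_prop),
        ← lintegral_add_left_eq_self (fun z => ENNReal.ofReal (sumDensity n (z - a)) * g z) a]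
      simp
    have hm := measurable_sumDensity n
    refine (lintegral_congr h1).trans ?_
    rw [lintegral_lintegral_swap (by fun_prop), sumMeasure,
      lintegral_withDensity_eq_lintegral_mul _ (measurable_sumDensity _).ennreal_ofReal hg]
    refine lintegral_congr fun z => ?_
    rw [lintegral_mul_const _ (by fun_prop), lintegral_Ici_sumDensity_sub]
    rfl

lemma pi_restrict_Ici_sum_le (n : ℕ) (c : ℝ) :
    (Measure.pi fun _ : Fin n => (volume : Measure ℝ).restrict (Set.Ici 0))
      {x | ∑ i, x i ≤ c} = ENNReal.ofReal (sumDensity n c) := by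
  cases n with
  | zero =>
    rw [Measure.pi_of_empty _ 0, Measure.dirac_apply]
    by_cases h : 0 ≤ c <;> simp [sumDensity, h]
  | succ n =>
    rw [← lintegral_Iic_sumDensity, ← withDensity_apply _ measurableSet_Iic]
    change _ = sumMeasure n _
    rw [← map_sum_pi_restrict_Ici, Measure.map_apply (by fun_prop) measurableSet_Iic]
    rfl

lemma lintegral_fin_prod_eq_prod {m : ℕ} (ν : Fin m → Measure ℝ) [∀ i, SigmaFinite (ν i)]
    (f : Fin m → ℝ → ENNReal) (hf : ∀ i, Measurable (f i)) :
    ∫⁻ x, ∏ i, f i (x i) ∂(Measure.pi ν) = ∏ i, ∫⁻ y, f i y ∂(ν i) := by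
  induction m with
  | zero => simp [Measure.pi_of_empty ν 0]
  | succ m ih =>
    have hf' : ∀ i : Fin m, Measurable (f i.succ) := fun i => hf _
    rw [← (measurePreserving_piFinSuccAbove ν 0).symm.lintegral_comp (by fun_prop)]
    simp only [MeasurableEquiv.piFinSuccAbove_symm_apply, Fin.insertNthEquiv, Equiv.coe_fn_mk,
      Fin.insertNth_zero', Fin.prod_univ_succ, Fin.cons_zero, Fin.cons_succ]
    rw [lintegral_prod_mul (f := f 0) (g := fun x : Fin m → ℝ => ∏ i, f i.succ (x i))
      (by fun_prop) (Finset.measurable_fun_prod _ fun i _ =>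
        (hf' i).comp (measurable_pi_apply i)).aemeasurable]
    congr 1
    exact ih (fun i => ν i.succ) (fun i => f i.succ) hf'

lemma pi_sumMeasure {m : ℕ} (n : Fin m → ℕ) :
    Measure.pi (fun i => sumMeasure (n i)) =
      volume.withDensity fun y : Fin m → ℝ => ∏ i, ENNReal.ofReal (sumDensity (n i) (y i)) := by
  refine Measure.pi_eq fun s hs => ?_
  rw [withDensity_apply _ (.univ_pi hs), volume_pi, Measure.restrict_pi_pi,
    lintegral_fin_prod_eq_prod _ (fun i y => ENNReal.ofReal (sumDensity (n i) y))
      fun i => (measurable_sumDensity _).ennreal_ofReal]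
  refine Finset.prod_congr rfl fun i _ => ?_
  rw [sumMeasure, withDensity_apply _ (hs i)]

lemma measurePreserving_piCurry_symm {ι : Type*} [Fintype ι] {κ : ι → Type*} [∀ i, Fintype (κ i)]
    (ν : Measure ℝ) [SigmaFinite ν] :
    MeasurePreserving (MeasurableEquiv.piCurry fun (i : ι) (_ : κ i) => ℝ).symm
      (Measure.pi fun i => Measure.pi fun _ : κ i => ν) (Measure.pi fun _ : Sigma κ => ν) := by
  refine ⟨MeasurableEquiv.measurable _, (Measure.pi_eq fun s hs => ?_).symm⟩
  rw [MeasurableEquiv.map_apply]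
  have : (MeasurableEquiv.piCurry fun (i : ι) (_ : κ i) => ℝ).symm ⁻¹' (Set.univ.pi s) =
      Set.univ.pi fun i => Set.univ.pi fun j => s ⟨i, j⟩ := by
    ext x
    simp [MeasurableEquiv.coe_piCurry_symm, Sigma.forall, Set.mem_pi, Sigma.uncurry]
  rw [this, Measure.pi_pi, Fintype.prod_sigma]
  simp_rw [Measure.pi_pi]

lemma volume_superlevel_eq_lintegral {m : ℕ} (a : ℕ) (n : Fin m → ℕ) (μ₀ : ℝ) (μ : Fin m → ℝ)
    (t : ℝ) :
    volume {l : Fin a ⊕ (Σ i, Fin (n i + 1)) → ℝ | (∀ j, 0 ≤ l j) ∧ ∑ j, l j ≤ 1 ∧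
      t ≤ μ₀ * (1 - ∑ j, l j) + ∑ j, Sum.elim (fun _ => μ₀) (fun p => μ p.1) j * l j} =
    ∫⁻ β in {β : Fin m → ℝ | t ≤ μ₀ * (1 - ∑ i, β i) + ∑ i, μ i * β i},
      (∏ i, ENNReal.ofReal (sumDensity (n i) (β i))) *
        ENNReal.ofReal (sumDensity a (1 - ∑ i, β i)) := by
  set ν : Measure ℝ := volume.restrict (Set.Ici 0) with hν
  set A : Set (Fin m → ℝ) := {β | t ≤ μ₀ * (1 - ∑ i, β i) + ∑ i, μ i * β i} with hA
  have hAm : MeasurableSet A := measurableSet_le (by fun_prop) (by fun_prop)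
  have hd := measurable_sumDensity
  set B : Set (Fin a ⊕ (Σ i, Fin (n i + 1)) → ℝ) := {l | ∑ j, l j ≤ 1 ∧
      t ≤ μ₀ * (1 - ∑ j, l j) + ∑ j, Sum.elim (fun _ => μ₀) (fun p => μ p.1) j * l j} with hB
  have hBm : MeasurableSet B := by
    rw [hB, Set.ofPred_and]
    exact (measurableSet_le (by fun_prop) (by fun_prop)).inter
      (measurableSet_le (by fun_prop) (by fun_prop))
  have hsplit : {l : Fin a ⊕ (Σ i, Fin (n i + 1)) → ℝ | (∀ j, 0 ≤ l j) ∧ ∑ j, l j ≤ 1 ∧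
      t ≤ μ₀ * (1 - ∑ j, l j) + ∑ j, Sum.elim (fun _ => μ₀) (fun p => μ p.1) j * l j} =
      B ∩ Set.univ.pi fun _ => Set.Ici 0 := by
    ext l
    simp only [hB, Set.mem_ofPred_eq, Set.mem_inter_iff, Set.mem_univ_pi, Set.mem_Ici]
    tauto
  rw [hsplit, ← Measure.restrict_apply hBm, volume_pi, Measure.restrict_pi_pi,
    ← (measurePreserving_sumPiEquivProdPi_symm fun _ => ν).measure_preimage
      hBm.nullMeasurableSet,
    Measure.prod_apply_symm ((MeasurableEquiv.measurable _) hBm)]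
  set F : (Fin m → ℝ) → ENNReal := A.indicator fun β =>
    ENNReal.ofReal (sumDensity a (1 - ∑ i, β i)) with hF
  have hFm : Measurable F := Measurable.indicator (by fun_prop) hAm
  have hmem : ∀ (x : Fin a → ℝ) (y : (Σ i, Fin (n i + 1)) → ℝ),
      (MeasurableEquiv.sumPiEquivProdPi fun _ => ℝ).symm (x, y) ∈ B ↔
        ∑ j, x j ≤ 1 - ∑ i, ∑ j, y ⟨i, j⟩ ∧ (fun i => ∑ j, y ⟨i, j⟩) ∈ A := by
    intro x y
    simp only [hA, hB, Set.mem_ofPred_eq, Fintype.sum_sum_type, Fintype.sum_sigma,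
      MeasurableEquiv.coe_sumPiEquivProdPi_symm, Equiv.sumPiEquivProdPi_symm_apply,
      Sum.elim_inl, Sum.elim_inr, ← Finset.mul_sum]
    rw [le_sub_iff_add_le]
    refine and_congr_right fun _ => ?_
    ring_nf
  have hslice : ∀ y : (Σ i, Fin (n i + 1)) → ℝ,
      (Measure.pi fun _ : Fin a => ν) ((fun x => (x, y)) ⁻¹'
        ((MeasurableEquiv.sumPiEquivProdPi fun _ => ℝ).symm ⁻¹' B)) =
      F fun i => ∑ j, y ⟨i, j⟩ := by
    intro y
    by_cases hy : (fun i => ∑ j, y ⟨i, j⟩) ∈ A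
    · rw [hF, Set.indicator_of_mem hy, ← pi_restrict_Ici_sum_le]
      congr 1 with x
      exact (hmem x y).trans (and_iff_left hy)
    · rw [hF, Set.indicator_of_notMem hy]
      convert measure_empty (μ := Measure.pi fun _ : Fin a => ν)
      ext x
      exact (hmem x y).trans (by simp [hy])
  rw [lintegral_congr hslice, ← (measurePreserving_piCurry_symm ν).lintegral_comp (by fun_prop)]
  have hpush := Measure.pi_map_pi (μ := fun i => Measure.pi fun _ : Fin (n i + 1) => ν)
    (f := fun i x => ∑ j, x j) (hμ := fun i => by
      rw [map_sum_pi_restrict_Ici]; infer_instance) (fun i => by fun_prop)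
  simp_rw [hν, map_sum_pi_restrict_Ici, pi_sumMeasure] at hpush
  refine (lintegral_map (f := F) (g := fun x : (i : Fin m) → Fin (n i + 1) → ℝ =>
    fun i => ∑ j, x i j) hFm (by fun_prop)).symm.trans ?_
  rw [hpush, lintegral_withDensity_eq_lintegral_mul _ (by fun_prop) hFm,
    ← lintegral_indicator hAm]
  refine lintegral_congr fun β => ?_
  by_cases hβ : β ∈ A <;> simp [hF, hβ]

lemma setIntegral_eq_toReal_lintegral {m : ℕ} (a : ℕ) (n : Fin m → ℕ) (μ₀ : ℝ) (μ : Fin m → ℝ)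
    (t : ℝ) :
    ∫ β in {β : Fin m → ℝ | (∀ i, 0 ≤ β i) ∧ ∑ i, β i ≤ 1 ∧
        t ≤ μ₀ * (1 - ∑ i, β i) + ∑ i, μ i * β i},
      ((1 - ∑ i, β i) ^ a * ∏ i, β i ^ n i) / (a.factorial * ∏ i, ((n i).factorial : ℝ)) =
    (∫⁻ β in {β : Fin m → ℝ | t ≤ μ₀ * (1 - ∑ i, β i) + ∑ i, μ i * β i},
      (∏ i, ENNReal.ofReal (sumDensity (n i) (β i))) *
        ENNReal.ofReal (sumDensity a (1 - ∑ i, β i))).toReal := by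
  set A : Set (Fin m → ℝ) := {β | t ≤ μ₀ * (1 - ∑ i, β i) + ∑ i, μ i * β i} with hA
  have hAm : MeasurableSet A := measurableSet_le (by fun_prop) (by fun_prop)
  set S : Set (Fin m → ℝ) := {β | (∀ i, 0 ≤ β i) ∧ ∑ i, β i ≤ 1} with hS
  have hSm : MeasurableSet S := by
    rw [hS, Set.ofPred_and, Set.ofPred_forall]
    exact (MeasurableSet.iInter fun i => measurableSet_le (by fun_prop) (by fun_prop)).inter
      (measurableSet_le (by fun_prop) (by fun_prop))
  have hset : {β : Fin m → ℝ | (∀ i, 0 ≤ β i) ∧ ∑ i, β i ≤ 1 ∧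
        t ≤ μ₀ * (1 - ∑ i, β i) + ∑ i, μ i * β i} = S ∩ A := by
    ext β
    simp [hS, hA, and_assoc]
  rw [hset, integral_eq_lintegral_of_nonneg_ae, ← Measure.restrict_restrict hSm,
    ← lintegral_indicator hSm]
  · congr 2 with β
    by_cases hβ : β ∈ S
    · have h1 : 0 ≤ 1 - ∑ i, β i := sub_nonneg.2 hβ.2
      rw [Set.indicator_of_mem hβ, ← ENNReal.ofReal_prod_of_nonneg, ← ENNReal.ofReal_mul]
      · simp only [sumDensity, Set.mem_Ici, hβ.1, h1, Set.indicator_of_mem,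
          Finset.prod_div_distrib]
        congr 1
        rw [div_mul_div_comm, mul_comm, mul_comm (a.factorial : ℝ)]
      · exact Finset.prod_nonneg fun i _ => sumDensity_nonneg _ _
      · exact fun i _ => sumDensity_nonneg _ _
    · rw [Set.indicator_of_notMem hβ, eq_comm]
      by_cases h1 : ∑ i, β i ≤ 1
      · obtain ⟨i, hi⟩ : ∃ i, ¬ 0 ≤ β i := by
          by_contra! h
          exact hβ ⟨h, h1⟩
        rw [Finset.prod_eq_zero (Finset.mem_univ i) (by simp [sumDensity, hi]), zero_mul]
      · simp [sumDensity, h1]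
  · filter_upwards [ae_restrict_mem (hSm.inter hAm)] with β hβ
    have h1 : 0 ≤ 1 - ∑ i, β i := sub_nonneg.2 hβ.1.2
    have h2 : 0 ≤ ∏ i, β i ^ n i := Finset.prod_nonneg fun i _ => pow_nonneg (hβ.1.1 i) _
    simp only [Pi.zero_apply]
    positivity
  · exact Measurable.aestronglyMeasurable (by fun_prop)

lemma volume_superlevel_comp_equiv {ι κ : Type*} [Fintype ι] [Fintype κ] (e : ι ≃ κ) (c : ℝ)
    (s : κ → ℝ) (t : ℝ) :
    volume {l : κ → ℝ | (∀ j, 0 ≤ l j) ∧ ∑ j, l j ≤ 1 ∧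
      t ≤ c * (1 - ∑ j, l j) + ∑ j, s j * l j} =
    volume {l : ι → ℝ | (∀ j, 0 ≤ l j) ∧ ∑ j, l j ≤ 1 ∧
      t ≤ c * (1 - ∑ j, l j) + ∑ j, s (e j) * l j} := by
  rw [← (volume_measurePreserving_piCongrLeft (fun _ : κ => ℝ) e).measure_preimage_equiv]
  congr 1 with l
  have h : ∀ j, MeasurableEquiv.piCongrLeft (fun _ : κ => ℝ) e l (e j) = l j := fun j =>
    Equiv.piCongrLeft_apply_apply (fun _ : κ => ℝ) e l j
  simp only [Set.mem_preimage, Set.mem_ofPred_eq, ← e.forall_congr_right, ← e.sum_comp, h]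

lemma sum_castLE_eq_sum_lt {M : Type*} [AddCommMonoid M] {m : ℕ} (i : Fin m) (f : Fin m → M) :
    ∑ i' : Fin i.1, f (Fin.castLE i.2.le i') =
      ∑ i' ∈ Finset.univ.filter (fun i' => i' < i), f i' :=
  Finset.sum_bij (fun i' _ => Fin.castLE i.2.le i') (fun i' _ => by simp [← Fin.val_fin_lt])
    (fun _ _ _ _ h => Fin.castLE_injective _ h)
    (fun i' hi' => ⟨⟨i'.1, by simpa using hi'⟩, Finset.mem_univ _, rfl⟩) fun _ _ => rfl

/-- The weighted volume of the region of the `(ℓ-1)`-simplex where the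
slope functional exceeds `t` equals the Lebesgue volume of the corresponding region
of the `(r-1)`-simplex for the expanded slope vector `s`. -/
theorem stmt6 (ℓ r : ℕ) (hℓ : 1 ≤ ℓ)
    (rk : Fin ℓ → ℕ) (hrk : ∀ i, 1 ≤ rk i) (hsum : (∑ i, rk i) = r)
    (μ : Fin ℓ → ℝ) (t : ℝ)
    (s : Fin r → ℝ)
    (hs : ∀ (i : Fin ℓ) (j : Fin r),
      (∑ i' ∈ Finset.univ.filter (fun i' : Fin ℓ => i' < i), rk i') ≤ j.1 →
      j.1 < (∑ i' ∈ Finset.univ.filter (fun i' : Fin ℓ => i' ≤ i), rk i') →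
      s j = μ i) :
    (∫ β in {β : Fin (ℓ - 1) → ℝ | (∀ i, 0 ≤ β i) ∧ (∑ i, β i) ≤ 1 ∧
        t ≤ μ ⟨0, by omega⟩ * (1 - ∑ i, β i) +
          ∑ i : Fin (ℓ - 1), μ ⟨i.1 + 1, by have := i.isLt; omega⟩ * β i},
        ((1 - ∑ i, β i) ^ (rk ⟨0, by omega⟩ - 1) *
            ∏ i : Fin (ℓ - 1), β i ^ (rk ⟨i.1 + 1, by have := i.isLt; omega⟩ - 1)) /
          (∏ i : Fin ℓ, (Nat.factorial (rk i - 1) : ℝ))) =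
      (volume {l : Fin (r - 1) → ℝ | (∀ j, 0 ≤ l j) ∧ (∑ j, l j) ≤ 1 ∧
        t ≤ s ⟨0, by
              have hpos : 0 < ∑ i, rk i :=
                Finset.sum_pos (fun i _ => hrk i) ⟨⟨0, by omega⟩, Finset.mem_univ _⟩
              omega⟩ * (1 - ∑ j, l j) +
          ∑ j : Fin (r - 1), s ⟨j.1 + 1, by have := j.isLt; omega⟩ * l j}).toReal := by
  obtain ⟨m, rfl⟩ : ∃ m, ℓ = m + 1 := ⟨ℓ - 1, by omega⟩
  have hrk' : ∀ i, rk i - 1 + 1 = rk i := fun i => Nat.sub_add_cancel (hrk i)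
  have hr : (rk 0 - 1) + ∑ i : Fin m, (rk i.succ - 1 + 1) + 1 = r := by
    simp only [hrk']
    rw [← hsum, Fin.sum_univ_succ, ← hrk' 0]
    omega
  obtain ⟨k, rfl⟩ : ∃ k, r = k + 1 := ⟨_, hr.symm⟩
  let e : Fin (rk 0 - 1) ⊕ (Σ i : Fin m, Fin (rk i.succ - 1 + 1)) ≃ Fin k :=
    ((Equiv.sumCongr (Equiv.refl _) finSigmaFinEquiv).trans finSumFinEquiv).trans
      (finCongr (Nat.succ.inj hr))
  have hlt : ∀ (i : Fin (m + 1)), (∑ i' ∈ Finset.univ.filter (fun i' => i' ≤ i), rk i') =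
      (∑ i' ∈ Finset.univ.filter (fun i' => i' < i), rk i') + rk i := by
    intro i
    rw [show (Finset.univ.filter fun i' => i' ≤ i) =
      insert i (Finset.univ.filter fun i' => i' < i) by ext; simp [le_iff_eq_or_lt],
      Finset.sum_insert (by simp), add_comm]
  have hs₀ : ∀ j : Fin (k + 1), j.1 < rk 0 → s j = μ 0 := fun j hj =>
    hs 0 j (by simp) (by rw [hlt]; simpa using hj)
  have hse : ∀ j, s (e j).succ = Sum.elim (fun _ => μ 0) (fun p => μ p.1.succ) j := by
    rintro (j | ⟨i, j⟩)
    · refine hs₀ _ ?_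
      have := j.2
      simp only [e, Equiv.trans_apply, Equiv.sumCongr_apply, Sum.map_inl, Equiv.refl_apply,
        finSumFinEquiv_apply_left, finCongr_apply, Fin.val_succ, Fin.val_cast, Fin.val_castAdd]
      omega
    · have hval : ((e (.inr ⟨i, j⟩)).succ : ℕ) =
          (∑ i' ∈ Finset.univ.filter (fun i' => i' < i.succ), rk i') + j := by
        simp only [e, Equiv.trans_apply, Equiv.sumCongr_apply, Sum.map_inr,
          finSumFinEquiv_apply_right, finCongr_apply, Fin.val_succ, Fin.val_cast,
          Fin.val_natAdd, finSigmaFinEquiv_apply, hrk']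
        have : ∑ i' ∈ Finset.univ.filter (fun i' => i' < i.succ), rk i' =
            rk 0 + ∑ i' : Fin i.1, rk (Fin.castLE i.2.le i').succ := by
          rw [Finset.sum_filter, Fin.sum_univ_succ,
            sum_castLE_eq_sum_lt i fun i' => rk i'.succ, Finset.sum_filter]
          simp
        have := hrk' 0
        omega
      refine hs i.succ _ (by omega) ?_
      rw [hlt, hval]
      have := j.2.trans_eq (hrk' i.succ)
      omega
  have hvol := volume_superlevel_comp_equiv e (s 0) (fun j => s j.succ) t
  simp only [hse, hs₀ 0 (hrk 0)] at hvol
  replace hvol := hvol.trans (volume_superlevel_eq_lintegral (rk 0 - 1)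
    (fun i => rk i.succ - 1) (μ 0) (fun i => μ i.succ) t)
  have hint := setIntegral_eq_toReal_lintegral (rk 0 - 1) (fun i : Fin m => rk i.succ - 1) (μ 0)
    (fun i => μ i.succ) t
  rw [← hvol, ← Fin.prod_univ_succ (fun i => ((rk i - 1).factorial : ℝ))] at hint
  have h0 : s ⟨0, k.succ_pos⟩ = μ 0 := hs₀ 0 (hrk 0)
  rw [h0]
  exact hint
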